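/- Let ζ be an Eilenberg–Moore law of a monad T over an endofunctor F on a category C with terminal object 1, and let c : X → F(T(X)) be an FT-coalgebra. Define the graded behaviour maps c^{(n)} : X → F^n(T(1)) by c^{(0)} = T(!_X) ∘ η_X and c^{(n+1)} = F^{n+1}(μ_1) ∘ F(ζ^{(n)}_{T(1)}) ∘ F(T(c^{(n)})) ∘ c, and define the final-chain projections of the determinization f_n : T(X) → F^n(1) by f_0 = !_{T(X)} and f_{n+1} = F(f_n) ∘ c^#, where c^# = F(μ_X) ∘ ζ_{T(X)} ∘ T(c). Then for every n: f_n ∘ η_X = F^n(!_{T(1)}) ∘ c^{(n)}, where !_{T(1)} : T(1) → 1 is the unique morphism to the terminal object. (In particular, if T is affine, i.e. !_{T(1)} is an isomorphism, the graded semantics of x agrees with the canonical cone of the determinization at η_X(x).) -/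

import Mathlib

open CategoryTheory CategoryTheory.Limits

universe v u

variable {C : Type u} [Category.{v} C]

/-- The n-fold composite of an endofunctor, with `F^(n+1) = F ∘ F^n`. -/
def Fpow (F : C ⥤ C) : ℕ → C ⥤ C
  | 0 => 𝟭 C
  | n + 1 => Fpow F n ⋙ F

/-- The iterated Eilenberg–Moore law `ζ^(n) : T F^n ⟶ F^n T`. -/
def zetaIter (T F : C ⥤ C) (ζ : ∀ X : C, T.obj (F.obj X) ⟶ F.obj (T.obj X)) :
    ∀ (n : ℕ) (X : C), T.obj ((Fpow F n).obj X) ⟶ (Fpow F n).obj (T.obj X)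
  | 0, X => 𝟙 (T.obj X)
  | n + 1, X => ζ ((Fpow F n).obj X) ≫ F.map (zetaIter T F ζ n X)

variable [HasTerminal C]

/-- The graded behaviour maps `c^(n) : X ⟶ F^n T 1` of an FT-coalgebra `c`:
`c^(0) = T ! ∘ η_X` and `c^(n+1) = F^(n+1) μ_1 ∘ F ζ^(n)_{T 1} ∘ F T c^(n) ∘ c`. -/
noncomputable def behav (T F : C ⥤ C) (η : ∀ X : C, X ⟶ T.obj X)
    (μ : ∀ X : C, T.obj (T.obj X) ⟶ T.obj X)
    (ζ : ∀ X : C, T.obj (F.obj X) ⟶ F.obj (T.obj X))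
    (X : C) (c : X ⟶ F.obj (T.obj X)) : ∀ n : ℕ, X ⟶ (Fpow F n).obj (T.obj (⊤_ C))
  | 0 => η X ≫ T.map (terminal.from X)
  | n + 1 =>
      c ≫ F.map (T.map (behav T F η μ ζ X c n)) ≫
        F.map (zetaIter T F ζ n (T.obj (⊤_ C))) ≫ (Fpow F (n + 1)).map (μ (⊤_ C))

/-- The canonical cone (final-chain projections) of the determinization
`c^# = F μ_X ∘ ζ_{T X} ∘ T c`: `f_0 = !` and `f_(n+1) = F f_n ∘ c^#`. -/
noncomputable def finalProj (T F : C ⥤ C) (μ : ∀ X : C, T.obj (T.obj X) ⟶ T.obj X)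
    (ζ : ∀ X : C, T.obj (F.obj X) ⟶ F.obj (T.obj X))
    (X : C) (c : X ⟶ F.obj (T.obj X)) : ∀ n : ℕ, T.obj X ⟶ (Fpow F n).obj (⊤_ C)
  | 0 => terminal.from (T.obj X)
  | n + 1 =>
      (T.map c ≫ ζ (T.obj X) ≫ F.map (μ X)) ≫ F.map (finalProj T F μ ζ X c n)

theorem zetaIter_naturality {D : Type u} [Category.{v} D] (T F : D ⥤ D)
    (ζ : ∀ X : D, T.obj (F.obj X) ⟶ F.obj (T.obj X))
    (hζ_nat : ∀ {X Y : D} (f : X ⟶ Y), T.map (F.map f) ≫ ζ Y = ζ X ≫ F.map (T.map f))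
    (n : ℕ) {X Y : D} (f : X ⟶ Y) :
    T.map ((Fpow F n).map f) ≫ zetaIter T F ζ n Y =
      zetaIter T F ζ n X ≫ (Fpow F n).map (T.map f) := by
  induction n with
  | zero => exact (Category.comp_id _).trans (Category.id_comp _).symm
  | succ n ih =>
    change T.map (F.map ((Fpow F n).map f)) ≫ ζ _ ≫ F.map (zetaIter T F ζ n Y) =
      (ζ _ ≫ F.map (zetaIter T F ζ n X)) ≫ F.map ((Fpow F n).map (T.map f))
    rw [reassoc_of% hζ_nat ((Fpow F n).map f), Category.assoc, ← F.map_comp, ← F.map_comp, ih]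

/-- The determinization `c^#` is a morphism of `T`-algebras from the free algebra on `X`. -/
theorem determinization_algebra_hom {D : Type u} [Category.{v} D] (T F : D ⥤ D)
    (μ : ∀ X : D, T.obj (T.obj X) ⟶ T.obj X)
    (hμ_nat : ∀ {X Y : D} (f : X ⟶ Y), T.map (T.map f) ≫ μ Y = μ X ≫ T.map f)
    (h_assoc : ∀ X : D, T.map (μ X) ≫ μ X = μ (T.obj X) ≫ μ X)
    (ζ : ∀ X : D, T.obj (F.obj X) ⟶ F.obj (T.obj X))
    (hζ_nat : ∀ {X Y : D} (f : X ⟶ Y), T.map (F.map f) ≫ ζ Y = ζ X ≫ F.map (T.map f))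
    (hζ_μ : ∀ X : D, μ (F.obj X) ≫ ζ X = T.map (ζ X) ≫ ζ (T.obj X) ≫ F.map (μ X))
    (X : D) (c : X ⟶ F.obj (T.obj X)) :
    T.map (T.map c ≫ ζ (T.obj X) ≫ F.map (μ X)) ≫ ζ (T.obj X) ≫ F.map (μ X) =
      μ X ≫ T.map c ≫ ζ (T.obj X) ≫ F.map (μ X) := by
  rw [← reassoc_of% hμ_nat c, reassoc_of% hζ_μ (T.obj X)]
  simp only [Functor.map_comp, Category.assoc]
  rw [reassoc_of% hζ_nat (μ X), ← F.map_comp, h_assoc, F.map_comp]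

/-- The final-chain projections are morphisms of `T`-algebras, where `F^n 1` carries the
structure `F^n ! ∘ ζ^(n)_1`. -/
theorem finalProj_algebra_hom (T F : C ⥤ C)
    (μ : ∀ X : C, T.obj (T.obj X) ⟶ T.obj X)
    (hμ_nat : ∀ {X Y : C} (f : X ⟶ Y), T.map (T.map f) ≫ μ Y = μ X ≫ T.map f)
    (h_assoc : ∀ X : C, T.map (μ X) ≫ μ X = μ (T.obj X) ≫ μ X)
    (ζ : ∀ X : C, T.obj (F.obj X) ⟶ F.obj (T.obj X))
    (hζ_nat : ∀ {X Y : C} (f : X ⟶ Y), T.map (F.map f) ≫ ζ Y = ζ X ≫ F.map (T.map f))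
    (hζ_μ : ∀ X : C, μ (F.obj X) ≫ ζ X = T.map (ζ X) ≫ ζ (T.obj X) ≫ F.map (μ X))
    (X : C) (c : X ⟶ F.obj (T.obj X)) (n : ℕ) :
    T.map (finalProj T F μ ζ X c n) ≫ zetaIter T F ζ n (⊤_ C) ≫
        (Fpow F n).map (terminal.from (T.obj (⊤_ C))) =
      μ X ≫ finalProj T F μ ζ X c n := by
  induction n with
  | zero => exact terminal.hom_ext _ _
  | succ n ih =>
    change T.map ((T.map c ≫ ζ (T.obj X) ≫ F.map (μ X)) ≫ F.map (finalProj T F μ ζ X c n)) ≫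
        (ζ _ ≫ F.map (zetaIter T F ζ n (⊤_ C))) ≫
          F.map ((Fpow F n).map (terminal.from (T.obj (⊤_ C)))) =
      μ X ≫ (T.map c ≫ ζ (T.obj X) ≫ F.map (μ X)) ≫ F.map (finalProj T F μ ζ X c n)
    have h := determinization_algebra_hom T F μ hμ_nat h_assoc ζ hζ_nat hζ_μ X c
    rw [T.map_comp, Category.assoc, Category.assoc,
      reassoc_of% hζ_nat (finalProj T F μ ζ X c n), ← F.map_comp, ← F.map_comp, ih, F.map_comp]
    simpa only [Category.assoc] using h =≫ F.map (finalProj T F μ ζ X c n)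

/-- the graded behaviour of a state agrees, modulo `F^n !_{T 1}`,
with the canonical cone of the determinization at `η_X(x)`:
`f_n ∘ η_X = F^n(!_{T 1}) ∘ c^(n)`. -/
theorem finalProj_eta_eq_behav
    (T : C ⥤ C) (F : C ⥤ C)
    (η : ∀ X : C, X ⟶ T.obj X) (μ : ∀ X : C, T.obj (T.obj X) ⟶ T.obj X)
    (hη_nat : ∀ {X Y : C} (f : X ⟶ Y), f ≫ η Y = η X ≫ T.map f)
    (hμ_nat : ∀ {X Y : C} (f : X ⟶ Y), T.map (T.map f) ≫ μ Y = μ X ≫ T.map f)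
    (h_unit_l : ∀ X : C, η (T.obj X) ≫ μ X = 𝟙 (T.obj X))
    (h_unit_r : ∀ X : C, T.map (η X) ≫ μ X = 𝟙 (T.obj X))
    (h_assoc : ∀ X : C, T.map (μ X) ≫ μ X = μ (T.obj X) ≫ μ X)
    (ζ : ∀ X : C, T.obj (F.obj X) ⟶ F.obj (T.obj X))
    (hζ_nat : ∀ {X Y : C} (f : X ⟶ Y), T.map (F.map f) ≫ ζ Y = ζ X ≫ F.map (T.map f))
    (hζ_η : ∀ X : C, η (F.obj X) ≫ ζ X = F.map (η X))
    (hζ_μ : ∀ X : C, μ (F.obj X) ≫ ζ X = T.map (ζ X) ≫ ζ (T.obj X) ≫ F.map (μ X))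
    (X : C) (c : X ⟶ F.obj (T.obj X)) (n : ℕ) :
    η X ≫ finalProj T F μ ζ X c n =
      behav T F η μ ζ X c n ≫ (Fpow F n).map (terminal.from (T.obj (⊤_ C))) := by
  induction n with
  | zero => exact terminal.hom_ext _ _
  | succ n ih =>
    have hterm : μ (⊤_ C) ≫ terminal.from (T.obj (⊤_ C)) =
        T.map (terminal.from (T.obj (⊤_ C))) ≫ terminal.from (T.obj (⊤_ C)) :=
      terminal.hom_ext _ _
    have hproj : finalProj T F μ ζ X c n =
        T.map (behav T F η μ ζ X c n) ≫ zetaIter T F ζ n (T.obj (⊤_ C)) ≫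
          (Fpow F n).map (μ (⊤_ C)) ≫ (Fpow F n).map (terminal.from (T.obj (⊤_ C))) := by
      rw [← Functor.map_comp, hterm, Functor.map_comp,
        ← reassoc_of% zetaIter_naturality T F ζ hζ_nat n (terminal.from (T.obj (⊤_ C))),
        ← T.map_comp_assoc, ← ih, T.map_comp, Category.assoc,
        finalProj_algebra_hom T F μ hμ_nat h_assoc ζ hζ_nat hζ_μ X c n,
        reassoc_of% h_unit_r X]
    change η X ≫ (T.map c ≫ ζ (T.obj X) ≫ F.map (μ X)) ≫ F.map (finalProj T F μ ζ X c n) =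
      (c ≫ F.map (T.map (behav T F η μ ζ X c n)) ≫
        F.map (zetaIter T F ζ n (T.obj (⊤_ C))) ≫ F.map ((Fpow F n).map (μ (⊤_ C)))) ≫
          F.map ((Fpow F n).map (terminal.from (T.obj (⊤_ C))))
    simp only [Category.assoc, ← F.map_comp]
    rw [← hproj, ← reassoc_of% hη_nat c, reassoc_of% hζ_η (T.obj X), ← F.map_comp,
      reassoc_of% h_unit_l X]
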